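/- Let k ≥ 2, let α ∈ ℝ^{k−1} satisfy ω^×(α) < (k−1)/(k−2) (for k = 2 this condition reads ω^×(α) < ∞), and let γ ∈ ℝ^{k−1}. There exists ε_0 > 0, depending only on k and α, such that for every ε ∈ (0, ε_0] there exist c > 0 and N_0 ∈ ℕ with: for all integers N ≥ N_0, T*_N(α, γ) := Σ_{n ≤ N, n ∈ G} φ(n)/(n ‖nα_1 − γ_1‖ ⋯ ‖nα_{k−1} − γ_{k−1}‖) ≥ c N (log N)^{k−1}, where φ is Euler's totient function. -/

import Mathlib

open scoped BigOperators
open Filter MeasureTheory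

/-- Distance from `x` to the nearest integer. -/
noncomputable def dn (x : ℝ) : ℝ := |x - round x|

/-- Multiplicative exponent `ω^×(α)`: the supremum of the set of real numbers `w` such
that `‖nα₁‖⋯‖nα_d‖ < n^{-w}` holds for infinitely many `n ∈ ℕ`. -/
noncomputable def multExp {d : ℕ} (α : Fin d → ℝ) : EReal :=
  sSup {w : EReal | ∃ v : ℝ, w = (v : ℝ) ∧
    {n : ℕ | 0 < n ∧ ∏ i, dn (n * α i) < (n : ℝ) ^ (-v)}.Infinite}

/-- The bound `(k-1)/(k-2)`, read as `∞` when `k = 2`. -/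
noncomputable def mBound (k : ℕ) : EReal :=
  if k = 2 then ⊤ else ((((k : ℝ) - 1) / ((k : ℝ) - 2) : ℝ) : EReal)

/-- The restricted set `G = {n ∈ ℕ : ‖nα_i - γ_i‖ ≥ n^{-√ε} for all i}`. -/
def Gset {d : ℕ} (α γ : Fin d → ℝ) (ε : ℝ) : Set ℕ :=
  {n : ℕ | ∀ i, (n : ℝ) ^ (-(Real.sqrt ε)) ≤ dn ((n : ℝ) * α i - γ i)}

theorem dn_le (x : ℝ) (m : ℤ) : dn x ≤ |x - m| := round_le x m

theorem dn_nonneg (x : ℝ) : 0 ≤ dn x := abs_nonneg _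

theorem dn_add_le (x y : ℝ) : dn (x + y) ≤ dn x + dn y := by
  refine (dn_le _ (round x + round y)).trans ?_
  have : x + y - ((round x + round y : ℤ) : ℝ) = (x - round x) + (y - round y) := by
    push_cast; ring
  rw [this]
  exact abs_add_le _ _

theorem dn_intCast_mul_le (h : ℤ) (x : ℝ) : dn (h * x) ≤ |(h : ℝ)| * dn x := by
  refine (dn_le _ (h * round x)).trans_eq ?_
  rw [dn, ← abs_mul]
  push_cast
  ring_nf

theorem dn_neg_le (x : ℝ) : dn (-x) ≤ dn x := by
  simpa using dn_intCast_mul_le (-1) x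

theorem dn_abs_intCast_mul_le (h : ℤ) (x : ℝ) : dn (|(h : ℝ)| * x) ≤ dn (h * x) := by
  rcases abs_choice (h : ℝ) with e | e <;> rw [e]
  rw [neg_mul]
  exact dn_neg_le _

theorem dn_sum_le {ι : Type*} (s : Finset ι) (f : ι → ℝ) :
    dn (∑ i ∈ s, f i) ≤ ∑ i ∈ s, dn (f i) := by
  classical
  induction s using Finset.induction_on with
  | empty => simp [dn]
  | insert a s ha ih =>
    rw [Finset.sum_insert ha, Finset.sum_insert ha]
    exact (dn_add_le _ _).trans (by linarith)

/-- Dirichlet's theorem on simultaneous approximation. -/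
theorem exists_dn_le_inv {ι : Type*} [Fintype ι] (α : ι → ℝ) (X : ℕ) (hX : 0 < X) :
    ∃ n : ℕ, 0 < n ∧ n ≤ X ^ Fintype.card ι ∧ ∀ i, dn (n * α i) ≤ (X : ℝ)⁻¹ := by
  classical
  have hX' : (0 : ℝ) < X := by exact_mod_cast hX
  have hlt (n : ℕ) (i : ι) : ⌊(X : ℝ) * Int.fract ((n : ℝ) * α i)⌋₊ < X := by
    rw [Nat.floor_lt (by have := Int.fract_nonneg ((n : ℝ) * α i); positivity)]
    nlinarith [Int.fract_lt_one ((n : ℝ) * α i)]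
  let f : Fin (X ^ Fintype.card ι + 1) → ι → Fin X := fun n i => ⟨_, hlt n i⟩
  obtain ⟨a, b, hab, hf⟩ := Fintype.exists_ne_map_eq_of_card_lt f (by simp)
  wlog hlt' : a < b generalizing a b
  · exact this b a hab.symm hf.symm (lt_of_le_of_ne (not_lt.mp hlt') hab.symm)
  have hlt'' : (a : ℕ) < b := hlt'
  refine ⟨b - a, by omega, by have := b.2; omega, fun i => ?_⟩
  have h1 : ⌊(X : ℝ) * Int.fract (((a : ℕ) : ℝ) * α i)⌋₊ =
      ⌊(X : ℝ) * Int.fract (((b : ℕ) : ℝ) * α i)⌋₊ := congrArg Fin.val (congrFun hf i)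
  set u := Int.fract (((a : ℕ) : ℝ) * α i) with hu
  set w := Int.fract (((b : ℕ) : ℝ) * α i) with hw
  have hu0 : 0 ≤ (X : ℝ) * u := mul_nonneg hX'.le (Int.fract_nonneg _)
  have hw0 : 0 ≤ (X : ℝ) * w := mul_nonneg hX'.le (Int.fract_nonneg _)
  have h2 : |(X : ℝ) * w - X * u| ≤ 1 := by
    have e1 := Nat.floor_le hu0
    have e2 := Nat.lt_floor_add_one ((X : ℝ) * u)
    have e3 := Nat.floor_le hw0
    have e4 := Nat.lt_floor_add_one ((X : ℝ) * w)
    rw [h1] at e1 e2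
    rw [abs_le]; constructor <;> linarith
  refine (dn_le _ (⌊((b : ℕ) : ℝ) * α i⌋ - ⌊((a : ℕ) : ℝ) * α i⌋)).trans ?_
  have h3 : (((b : ℕ) - (a : ℕ) : ℕ) : ℝ) * α i -
      ((⌊((b : ℕ) : ℝ) * α i⌋ - ⌊((a : ℕ) : ℝ) * α i⌋ : ℤ) : ℝ) = w - u := by
    rw [Nat.cast_sub hlt''.le, hu, hw, Int.fract, Int.fract]
    push_cast
    ring
  rw [h3, ← one_div, le_div_iff₀ hX', ← abs_of_pos hX', ← abs_mul]
  rwa [sub_mul, mul_comm w, mul_comm u]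

/-- Khintchine-type transference: a good rational relation between the `α i` produces an integer
at which all `α i` are simultaneously well approximated. -/
theorem exists_prod_dn_le {d : ℕ} (α : Fin d → ℝ) (h : Fin d → ℤ) (h0 : h ≠ 0) (H X : ℕ)
    (hX : 0 < X) (hH : ∀ i, |h i| ≤ H)
    (hd : dn (∑ i, h i * α i) ≤ ((X : ℝ) ^ d)⁻¹) :
    ∃ m : ℕ, 0 < m ∧ m ≤ H * X ^ (d - 1) ∧ ∏ i, dn (m * α i) ≤ d * ((H : ℝ) / X) ^ d := by
  classical
  obtain ⟨i0, hi0⟩ : ∃ i, h i ≠ 0 := by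
    by_contra! hc
    exact h0 (funext hc)
  have hdpos : 0 < d := i0.pos
  have hX' : (0 : ℝ) < X := by exact_mod_cast hX
  have hHR (i : Fin d) : |(h i : ℝ)| ≤ H := by exact_mod_cast hH i
  have hH1 : (1 : ℝ) ≤ H := by
    refine le_trans ?_ (hHR i0)
    exact_mod_cast Int.one_le_abs hi0
  obtain ⟨n, hn, hnX, hnd⟩ := exists_dn_le_inv (fun i : {i : Fin d // i ≠ i0} => α i) X hX
  have hcard : Fintype.card {i : Fin d // i ≠ i0} = d - 1 := by simp
  rw [hcard] at hnX
  have hother (i : Fin d) (hi : i ≠ i0) : dn (n * α i) ≤ (X : ℝ)⁻¹ := hnd ⟨i, hi⟩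
  have hcast : (((h i0).natAbs * n : ℕ) : ℝ) = |(h i0 : ℝ)| * n := by
    push_cast
    rw [Nat.cast_natAbs, Int.cast_abs]
  have hle : (h i0).natAbs ≤ H := by
    have := hH i0
    rw [Int.abs_eq_natAbs] at this
    exact_mod_cast this
  refine ⟨(h i0).natAbs * n, by positivity, Nat.mul_le_mul hle hnX, ?_⟩
  rw [hcast]
  have A (i : Fin d) (hi : i ≠ i0) : dn (|(h i0 : ℝ)| * n * α i) ≤ H / X := by
    rw [mul_assoc]
    refine (dn_abs_intCast_mul_le _ _).trans ((dn_intCast_mul_le _ _).trans ?_)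
    rw [div_eq_mul_inv]
    exact mul_le_mul (hHR _) (hother i hi) (dn_nonneg _) (by positivity)
  have B : dn (|(h i0 : ℝ)| * n * α i0) ≤ d * (H / X) := by
    rw [mul_assoc]
    refine (dn_abs_intCast_mul_le _ _).trans ?_
    have e : (h i0 : ℝ) * (n * α i0) =
        (n : ℤ) * (∑ i, h i * α i) + -(∑ i ∈ Finset.univ.erase i0, (h i : ℝ) * (n * α i)) := by
      rw [← Finset.add_sum_erase _ _ (Finset.mem_univ i0), mul_add, Finset.mul_sum]
      have : ∑ i ∈ Finset.univ.erase i0, ((n : ℤ) : ℝ) * (h i * α i) =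
        ∑ i ∈ Finset.univ.erase i0, (h i : ℝ) * (n * α i) :=
          Finset.sum_congr rfl fun i _ => by push_cast; ring
      rw [this]
      push_cast
      ring
    rw [e]
    have f1 : dn ((n : ℤ) * (∑ i, h i * α i)) ≤ H / X := by
      refine (dn_intCast_mul_le _ _).trans ?_
      have hn' : |((n : ℤ) : ℝ)| ≤ (X : ℝ) ^ (d - 1) := by
        rw [Int.cast_natCast, Nat.abs_cast]
        exact_mod_cast hnX
      calc _ ≤ (X : ℝ) ^ (d - 1) * ((X : ℝ) ^ d)⁻¹ :=
            mul_le_mul hn' hd (dn_nonneg _) (by positivity)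
        _ = 1 / X := by
            obtain ⟨e, rfl⟩ : ∃ e, d = e + 1 := ⟨d - 1, by omega⟩
            rw [Nat.add_sub_cancel, pow_succ]
            field_simp
        _ ≤ H / X := by gcongr
    have f2 : dn (∑ i ∈ Finset.univ.erase i0, (h i : ℝ) * (n * α i)) ≤
        (d - 1) * (H / X) := by
      refine (dn_sum_le _ _).trans ?_
      have : ∀ i ∈ Finset.univ.erase i0, dn ((h i : ℝ) * (n * α i)) ≤ (H : ℝ) / X := by
        intro i hi
        refine (dn_intCast_mul_le _ _).trans ?_
        rw [div_eq_mul_inv]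
        exact mul_le_mul (hHR _) (hother i (Finset.ne_of_mem_erase hi)) (dn_nonneg _)
          (by positivity)
      refine (Finset.sum_le_card_nsmul _ _ _ this).trans_eq ?_
      rw [Finset.card_erase_of_mem (Finset.mem_univ _), Finset.card_univ, Fintype.card_fin,
        nsmul_eq_mul, Nat.cast_sub hdpos, Nat.cast_one]
    refine (dn_add_le _ _).trans ?_
    have := dn_neg_le (∑ i ∈ Finset.univ.erase i0, (h i : ℝ) * (n * α i))
    linarith
  rw [← Finset.mul_prod_erase _ _ (Finset.mem_univ i0)]
  have C : ∏ i ∈ Finset.univ.erase i0, dn (|(h i0 : ℝ)| * n * α i) ≤ ((H : ℝ) / X) ^ (d - 1) := by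
    refine (Finset.prod_le_prod (fun i _ => dn_nonneg _)
      fun i hi => A i (Finset.ne_of_mem_erase hi)).trans_eq ?_
    rw [Finset.prod_const, Finset.card_erase_of_mem (Finset.mem_univ _), Finset.card_univ,
      Fintype.card_fin]
  calc _ ≤ d * ((H : ℝ) / X) * ((H : ℝ) / X) ^ (d - 1) :=
        mul_le_mul B C (Finset.prod_nonneg fun i _ => dn_nonneg _) (by positivity)
    _ = d * ((H : ℝ) / X) ^ d := by
        rw [mul_assoc, ← pow_succ', Nat.sub_add_cancel hdpos]

theorem exists_forall_one_le_mul_dn_sum {d : ℕ} (α : Fin d → ℝ) {c v : ℝ} (hc : 0 < c)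
    (hv : 0 ≤ v) (hvd : v * ((d : ℝ) - 1) < d)
    (hα : ∀ n : ℕ, 0 < n → c * (n : ℝ) ^ (-v) ≤ ∏ i, dn (n * α i)) :
    ∃ C W : ℕ, 0 < C ∧ ∀ h : Fin d → ℤ, h ≠ 0 → ∀ H : ℕ, (∀ i, |h i| ≤ H) →
      1 ≤ (C : ℝ) * (H : ℝ) ^ W * dn (∑ i, h i * α i) := by
  set s : ℝ := d - v * (d - 1) with hs
  have hs0 : 0 < s := by linarith
  obtain ⟨B, hB⟩ := exists_nat_ge ((d + v) / s)
  rw [div_le_iff₀ hs0] at hB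
  obtain ⟨C₁, hC₁⟩ : ∃ C₁ : ℕ, 0 < C₁ ∧ d / c < (C₁ : ℝ) ^ s :=
    ((Filter.eventually_gt_atTop 0).and (((tendsto_rpow_atTop hs0).comp
      tendsto_natCast_atTop_atTop).eventually_gt_atTop (d / c))).exists
  refine ⟨C₁ ^ d, B * d, by have := hC₁.1; positivity, fun h h0 H hH => ?_⟩
  by_contra! hlt
  obtain ⟨i0, hi0⟩ : ∃ i, h i ≠ 0 := by
    by_contra! hc
    exact h0 (funext hc)
  have hdpos : 0 < d := i0.pos
  have hH1 : 0 < H := by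
    have := hH i0
    have := Int.one_le_abs hi0
    omega
  have hC₁p := hC₁.1
  set X := C₁ * H ^ B with hX
  have hXp : 0 < X := by positivity
  have hXr : (0 : ℝ) < X := by exact_mod_cast hXp
  have hHr : (1 : ℝ) ≤ H := by exact_mod_cast hH1
  have hXd : ((C₁ ^ d : ℕ) : ℝ) * (H : ℝ) ^ (B * d) = (X : ℝ) ^ d := by
    rw [hX]; push_cast; rw [mul_pow, ← pow_mul]
  rw [hXd] at hlt
  obtain ⟨m, hm, hmX, hprod⟩ := exists_prod_dn_le α h h0 H X hXp hH (by
    rw [← one_div, le_div_iff₀ (by positivity), mul_comm]; exact hlt.le)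
  have h1 := (hα m hm).trans hprod
  have hmr : (0 : ℝ) < m := by exact_mod_cast hm
  have h2 : (m : ℝ) ^ v ≤ (H : ℝ) ^ v * (X : ℝ) ^ (v * (d - 1)) := by
    have : (m : ℝ) ≤ H * (X : ℝ) ^ ((d : ℝ) - 1) := by
      have e : (X : ℝ) ^ ((d : ℝ) - 1) = (X : ℝ) ^ (d - 1) := by
        rw [← Real.rpow_natCast, Nat.cast_sub hdpos, Nat.cast_one]
      rw [e]
      exact_mod_cast hmX
    refine (Real.rpow_le_rpow hmr.le this hv).trans_eq ?_
    rw [Real.mul_rpow (by positivity) (by positivity), ← Real.rpow_mul hXr.le, mul_comm v]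
  rw [Real.rpow_neg hmr.le, div_pow] at h1
  have h3 : c * (X : ℝ) ^ d ≤ d * (H : ℝ) ^ d * (m : ℝ) ^ v := by
    have hmv : (0 : ℝ) < (m : ℝ) ^ v := by positivity
    rw [← div_eq_mul_inv, ← mul_div_assoc, div_le_div_iff₀ hmv (by positivity)] at h1
    exact h1
  have h4 : c * (X : ℝ) ^ d ≤ d * (H : ℝ) ^ d * ((H : ℝ) ^ v * (X : ℝ) ^ (v * (d - 1))) :=
    h3.trans (by gcongr)
  have h5 : (X : ℝ) ^ d = (X : ℝ) ^ s * (X : ℝ) ^ (v * (d - 1)) := by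
    rw [← Real.rpow_add hXr, ← Real.rpow_natCast]; congr 1; rw [hs]; ring
  have h6 : c * (X : ℝ) ^ s ≤ d * (H : ℝ) ^ ((d : ℝ) + v) := by
    rw [h5, ← mul_assoc, ← mul_assoc] at h4
    have := le_of_mul_le_mul_right h4 (by positivity)
    rwa [mul_assoc (d : ℝ), ← Real.rpow_natCast (H : ℝ) d, ← Real.rpow_add (by linarith)] at this
  have h7 : (X : ℝ) ^ s = (C₁ : ℝ) ^ s * (H : ℝ) ^ ((B : ℝ) * s) := by
    rw [hX]; push_cast
    rw [Real.mul_rpow (by positivity) (by positivity), ← Real.rpow_natCast,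
      ← Real.rpow_mul (by linarith)]
  have h8 : (H : ℝ) ^ ((d : ℝ) + v) ≤ (H : ℝ) ^ ((B : ℝ) * s) :=
    Real.rpow_le_rpow_of_exponent_le hHr hB
  have h9 := hC₁.2
  rw [div_lt_iff₀ hc] at h9
  rw [h7] at h6
  have h10 : (0 : ℝ) < (H : ℝ) ^ ((B : ℝ) * s) := by positivity
  have : (d : ℝ) * (H : ℝ) ^ ((d : ℝ) + v) ≤ d * (H : ℝ) ^ ((B : ℝ) * s) := by gcongr
  nlinarith

/-- The multiplicative exponent controls the products uniformly. -/
theorem exists_le_prod_dn {d : ℕ} (α : Fin d → ℝ) (v : ℝ) (hv : multExp α < (v : EReal)) :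
    ∃ c : ℝ, 0 < c ∧ ∀ n : ℕ, 0 < n → c * (n : ℝ) ^ (-v) ≤ ∏ i, dn (n * α i) := by
  classical
  have hfin : {n : ℕ | 0 < n ∧ ∏ i, dn (n * α i) < (n : ℝ) ^ (-v)}.Finite := by
    by_contra hinf
    exact absurd (le_sSup (show (v : EReal) ∈ {w : EReal | ∃ v : ℝ, w = (v : ℝ) ∧
      {n : ℕ | 0 < n ∧ ∏ i, dn (n * α i) < (n : ℝ) ^ (-v)}.Infinite} from ⟨v, rfl, hinf⟩))
      (not_le.mpr hv)
  have hpos (n : ℕ) (hn : 0 < n) : 0 < ∏ i, dn (n * α i) := by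
    refine lt_of_le_of_ne (Finset.prod_nonneg fun i _ => dn_nonneg _) fun h => ?_
    obtain ⟨i, -, hi⟩ := Finset.prod_eq_zero_iff.mp h.symm
    refine (Set.infinite_of_injective_forall_mem (f := fun t : ℕ => (t + 1) * n)
      (fun a b hab => ?_) fun t => ?_) hfin
    · have := Nat.eq_of_mul_eq_mul_right hn hab
      omega
    · have hp : 0 < (t + 1) * n := by positivity
      refine ⟨hp, ?_⟩
      have : dn (((t + 1) * n : ℕ) * α i) = 0 := by
        refine le_antisymm ?_ (dn_nonneg _)
        have := dn_intCast_mul_le ((t + 1 : ℕ) : ℤ) (n * α i)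
        rw [hi, mul_zero] at this
        rwa [← mul_assoc, Int.cast_natCast, ← Nat.cast_mul] at this
      rw [Finset.prod_eq_zero (Finset.mem_univ i) this]
      have : (0 : ℝ) < ((t + 1) * n : ℕ) := by exact_mod_cast hp
      positivity
  set s := hfin.toFinset
  obtain ⟨c, hc0, hc⟩ : ∃ c : ℝ, 0 < c ∧ ∀ n ∈ s,
      c ≤ (∏ i, dn (n * α i)) * (n : ℝ) ^ v := by
    rcases s.eq_empty_or_nonempty with h | h
    · exact ⟨1, one_pos, by simp [h]⟩
    · obtain ⟨b, hb, hb'⟩ := s.exists_min_image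
        (fun n : ℕ => (∏ i, dn (n * α i)) * (n : ℝ) ^ v) h
      have hb0 : 0 < b := ((Set.Finite.mem_toFinset _).mp hb).1
      have : (0 : ℝ) < b := by exact_mod_cast hb0
      exact ⟨_, mul_pos (hpos b hb0) (by positivity), hb'⟩
  refine ⟨min c 1, by positivity, fun n hn => ?_⟩
  have hn' : (0 : ℝ) < n := by exact_mod_cast hn
  by_cases hns : n ∈ s
  · have h1 := hc n hns
    rw [Real.rpow_neg hn'.le, ← div_eq_mul_inv, div_le_iff₀ (by positivity)]
    exact (min_le_left _ _).trans h1
  · have h1 : (n : ℝ) ^ (-v) ≤ ∏ i, dn (n * α i) := by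
      by_contra! hcon
      exact hns ((Set.Finite.mem_toFinset _).mpr ⟨hn, hcon⟩)
    refine le_trans ?_ h1
    exact mul_le_of_le_one_left (by positivity) (min_le_right _ _)

/-- The additive character `e(x) = exp(2πix)`. -/
noncomputable def ee (x : ℝ) : ℂ := Complex.exp (2 * Real.pi * Complex.I * x)

theorem ee_add (x y : ℝ) : ee (x + y) = ee x * ee y := by
  rw [ee, ee, ee, ← Complex.exp_add]
  push_cast
  ring_nf

theorem ee_zero : ee 0 = 1 := by simp [ee]

theorem norm_ee (x : ℝ) : ‖ee x‖ = 1 := by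
  rw [ee, show (2 * Real.pi * Complex.I * x : ℂ) = ((2 * Real.pi * x : ℝ) : ℂ) * Complex.I by
    push_cast; ring]
  exact Complex.norm_exp_ofReal_mul_I _

theorem ee_intCast (m : ℤ) : ee m = 1 := by
  rw [ee, ← Complex.exp_int_mul_two_pi_mul_I m]
  push_cast
  ring_nf

theorem ee_sum {ι : Type*} (s : Finset ι) (f : ι → ℝ) : ee (∑ i ∈ s, f i) = ∏ i ∈ s, ee (f i) := by
  simp only [ee, ← Complex.exp_sum, ← Finset.mul_sum]
  push_cast
  rfl

theorem ee_nat_mul (n : ℕ) (x : ℝ) : ee (n * x) = ee x ^ n := by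
  rw [ee, ee, ← Complex.exp_nat_mul]
  push_cast
  ring_nf

theorem four_mul_dn_le (x : ℝ) : 4 * dn x ≤ ‖ee x - 1‖ := by
  have h1 : ee x = ee (x - round x) := by
    have := ee_add (x - round x) (round x : ℤ)
    rwa [sub_add_cancel, ee_intCast, mul_one] at this
  set t := x - round x with ht
  have hdn : dn x = |t| := rfl
  have hpi := Real.pi_pos
  have h2 : ‖ee t - 1‖ = 2 * |Real.sin (Real.pi * t)| := by
    have := Complex.norm_exp_I_mul_ofReal_sub_one (2 * Real.pi * t)
    rw [Real.norm_eq_abs, abs_mul, abs_two, show 2 * Real.pi * t / 2 = Real.pi * t by ring] at this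
    rw [← this, ee]
    push_cast
    ring_nf
  have ht2 : |t| ≤ 1 / 2 := abs_sub_round x
  have h3 : |Real.sin (Real.pi * t)| = Real.sin (Real.pi * |t|) := by
    rcases abs_cases t with ⟨e, e'⟩ | ⟨e, e'⟩ <;> rw [e] at ht2 ⊢
    · exact abs_of_nonneg (Real.sin_nonneg_of_nonneg_of_le_pi (by positivity) (by nlinarith))
    · rw [← abs_neg, ← Real.sin_neg, ← mul_neg]
      exact abs_of_nonneg (Real.sin_nonneg_of_nonneg_of_le_pi
        (mul_nonneg hpi.le (by linarith)) (by nlinarith))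
  have h4 := Real.mul_le_sin (x := Real.pi * |t|) (by positivity) (by nlinarith)
  rw [h1, h2, h3, hdn]
  have : 2 / Real.pi * (Real.pi * |t|) = 2 * |t| := by field_simp
  linarith

/-- Geometric sums of the additive character. -/
theorem norm_sum_ee_mul_dn_le (M : ℕ) (x : ℝ) :
    ‖∑ m ∈ Finset.Icc 1 M, ee (m * x)‖ * dn x ≤ 1 := by
  have h1 : (∑ m ∈ Finset.Icc 1 M, ee (m * x)) * (ee x - 1) = ee x ^ (M + 1) - ee x := by
    simp_rw [ee_nat_mul]
    rw [← Finset.Ico_add_one_right_eq_Icc, geom_sum_Ico_mul _ (by omega), pow_one]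
  have h2 : ‖∑ m ∈ Finset.Icc 1 M, ee (m * x)‖ * ‖ee x - 1‖ ≤ 2 := by
    rw [← norm_mul, h1]
    refine (norm_sub_le _ _).trans ?_
    rw [norm_pow, norm_ee, one_pow]
    norm_num
  nlinarith [four_mul_dn_le x, norm_nonneg (∑ m ∈ Finset.Icc 1 M, ee (m * x)), dn_nonneg x]

/-- `F` is the sum of a Fourier series with mean `μ` and coefficients bounded by `Q / h²`. -/
def HasQuadFourier (F : ℝ → ℝ) (μ Q : ℝ) : Prop :=
  ∃ c : ℤ → ℂ, c 0 = μ ∧ (∀ h : ℤ, h ≠ 0 → ‖c h‖ ≤ Q / (h : ℝ) ^ 2) ∧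
    ∀ x : ℝ, HasSum (fun h : ℤ => c h * ee (h * x)) (F x : ℂ)

theorem HasQuadFourier.add {F G : ℝ → ℝ} {μ ν Q R : ℝ} (hF : HasQuadFourier F μ Q)
    (hG : HasQuadFourier G ν R) : HasQuadFourier (fun x => F x + G x) (μ + ν) (Q + R) := by
  obtain ⟨c, c0, cb, cs⟩ := hF
  obtain ⟨b, b0, bb, bs⟩ := hG
  refine ⟨fun h => c h + b h, by simp [c0, b0], fun h hh => ?_, fun x => ?_⟩
  · rw [add_div]
    exact (norm_add_le _ _).trans (add_le_add (cb h hh) (bb h hh))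
  · simpa [add_mul] using (cs x).add (bs x)

theorem HasQuadFourier.const_mul {F : ℝ → ℝ} {μ Q : ℝ} (hF : HasQuadFourier F μ Q) (a : ℝ) :
    HasQuadFourier (fun x => a * F x) (a * μ) (|a| * Q) := by
  obtain ⟨c, c0, cb, cs⟩ := hF
  refine ⟨fun h => a * c h, by simp [c0], fun h hh => ?_, fun x => ?_⟩
  · rw [norm_mul, Complex.norm_real, Real.norm_eq_abs, mul_div_assoc]
    exact mul_le_mul_of_nonneg_left (cb h hh) (abs_nonneg _)
  · simpa [mul_assoc] using (cs x).mul_left (a : ℂ)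

theorem HasQuadFourier.comp_add {F : ℝ → ℝ} {μ Q : ℝ} (hF : HasQuadFourier F μ Q) (a : ℝ) :
    HasQuadFourier (fun x => F (x + a)) μ Q := by
  obtain ⟨c, c0, cb, cs⟩ := hF
  refine ⟨fun h => c h * ee (h * a), by simp [c0, ee_zero], fun h hh => ?_, fun x => ?_⟩
  · rw [norm_mul, norm_ee, mul_one]
    exact cb h hh
  · convert cs (x + a) using 2 with h
    rw [mul_add, ee_add]
    ring

theorem hasQuadFourier_const (μ : ℝ) : HasQuadFourier (fun _ => μ) μ 0 := by
  refine ⟨fun h => if h = 0 then (μ : ℂ) else 0, by simp, fun h hh => by simp [hh], fun x => ?_⟩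
  convert hasSum_ite_eq (0 : ℤ) (μ : ℂ) using 2 with h
  split_ifs with h0
  · simp [h0, ee_zero]
  · simp [h0]

theorem HasQuadFourier.sum {ι : Type*} (s : Finset ι) {F : ι → ℝ → ℝ} {μ Q : ι → ℝ}
    (hF : ∀ i ∈ s, HasQuadFourier (F i) (μ i) (Q i)) :
    HasQuadFourier (fun x => ∑ i ∈ s, F i x) (∑ i ∈ s, μ i) (∑ i ∈ s, Q i) := by
  classical
  induction s using Finset.induction_on with
  | empty => simpa using hasQuadFourier_const 0
  | insert a s ha ih =>
    simp only [Finset.sum_insert ha]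
    exact (hF a (by simp)).add (ih fun i hi => hF i (by simp [hi]))

theorem HasQuadFourier.mono {F : ℝ → ℝ} {μ Q R : ℝ} (hF : HasQuadFourier F μ Q) (h : Q ≤ R) :
    HasQuadFourier F μ R := by
  obtain ⟨c, c0, cb, cs⟩ := hF
  exact ⟨c, c0, fun n hn => (cb n hn).trans (by gcongr), cs⟩

theorem hasQuadFourier_bernoulliFun_two :
    HasQuadFourier (fun x => bernoulliFun 2 (Int.fract x)) 0 1 := by
  have hpi := Real.pi_gt_three
  refine ⟨fun h => 1 / (2 * Real.pi ^ 2) * (1 / (h : ℂ) ^ 2), by simp, fun h hh => ?_, fun x => ?_⟩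
  · beta_reduce
    have e : (1 / (2 * Real.pi ^ 2) * (1 / (h : ℂ) ^ 2) : ℂ) =
        ((1 / (2 * Real.pi ^ 2) * (1 / (h : ℝ) ^ 2) : ℝ) : ℂ) := by push_cast; ring
    rw [e, Complex.norm_real, Real.norm_of_nonneg (by positivity)]
    refine mul_le_of_le_one_left (by positivity) ?_
    rw [div_le_one (by positivity)]
    nlinarith
  · have h1 := (hasSum_one_div_pow_mul_fourier_mul_bernoulliFun le_rfl
      (x := Int.fract x) ⟨Int.fract_nonneg x, (Int.fract_lt_one x).le⟩).mul_left
      (1 / (2 * (Real.pi : ℂ) ^ 2))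
    have h2 : ∀ h : ℤ, ee (h * x) = fourier h ((Int.fract x : ℝ) : UnitAddCircle) := by
      intro h
      have e := ee_add (h * Int.fract x) ((h * ⌊x⌋ : ℤ) : ℝ)
      rw [ee_intCast, mul_one] at e
      rw [show (h : ℝ) * x = h * Int.fract x + ((h * ⌊x⌋ : ℤ) : ℝ) by
        rw [Int.fract]; push_cast; ring, e, fourier_coe_apply, ee]
      push_cast
      ring_nf
    simp_rw [h2, mul_assoc]
    have hpi' : (Real.pi : ℂ) ≠ 0 := by exact_mod_cast Real.pi_ne_zero
    have e : (bernoulliFun 2 (Int.fract x) : ℂ) = 1 / (2 * (Real.pi : ℂ) ^ 2) *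
        (-(2 * (Real.pi : ℂ) * Complex.I) ^ 2 / (Nat.factorial 2 : ℕ) *
          bernoulliFun 2 (Int.fract x)) := by
      norm_num [Nat.factorial, mul_pow]
      field_simp
      norm_num
    rw [e]
    exact h1

theorem max_sub_dn_eq {δ : ℝ} (h0 : 0 < δ) (h1 : δ ≤ 1 / 4) (x : ℝ) :
    max 0 (δ - dn x) = δ ^ 2 + (-(1 / 2)) * ((bernoulliFun 2 (Int.fract (x + δ)) +
      bernoulliFun 2 (Int.fract (x + -δ))) + (-2) * bernoulliFun 2 (Int.fract x)) := by
  have hdn : dn x = min (Int.fract x) (1 - Int.fract x) := abs_sub_round_eq_min x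
  have hx : x = ⌊x⌋ + Int.fract x := (Int.floor_add_fract x).symm
  have f0 := Int.fract_nonneg x
  have f1 := Int.fract_lt_one x
  rw [hdn]
  set f := Int.fract x with hf
  have key (y t : ℝ) (m : ℤ) (ht : 0 ≤ t) (ht1 : t < 1) (h : y = m + t) : Int.fract y = t := by
    rw [h, Int.fract_intCast_add, Int.fract_eq_self]
    exact ⟨ht, ht1⟩
  simp only [bernoulliFun_two]
  rcases lt_or_ge f δ with hc | hc
  · rw [key (x + δ) (f + δ) ⌊x⌋ (by linarith) (by linarith) (by linarith),
      key (x + -δ) (f - δ + 1) (⌊x⌋ - 1) (by linarith) (by linarith) (by push_cast; linarith),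
      min_eq_left (by linarith), max_eq_right (by linarith)]
    ring
  · rw [key (x + -δ) (f - δ) ⌊x⌋ (by linarith) (by linarith) (by linarith)]
    rcases lt_or_ge f (1 - δ) with hc' | hc'
    · rw [key (x + δ) (f + δ) ⌊x⌋ (by linarith) (by linarith) (by linarith),
        max_eq_left (by rcases min_cases f (1 - f) with h | h <;> linarith [h.1])]
      ring
    · rw [key (x + δ) (f + δ - 1) (⌊x⌋ + 1) (by linarith) (by linarith) (by push_cast; linarith),
        min_eq_right (by linarith), max_eq_right (by linarith)]
      ring

theorem hasQuadFourier_max_sub_dn {δ : ℝ} (h0 : 0 < δ) (h1 : δ ≤ 1 / 4) :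
    HasQuadFourier (fun x => max 0 (δ - dn x)) (δ ^ 2) 2 := by
  have hb := hasQuadFourier_bernoulliFun_two
  have := (hasQuadFourier_const (δ ^ 2)).add
    ((((hb.comp_add δ).add (hb.comp_add (-δ))).add (hb.const_mul (-2))).const_mul (-(1 / 2)))
  simp only [← max_sub_dn_eq h0 h1] at this
  convert this using 1 <;> norm_num [abs_of_pos]

theorem dn_bounds_of_dn_sub_lt {δ x : ℝ} (h1 : δ ≤ 1 / 4) (h : dn (x - 2 * δ) < δ) :
    δ < dn x ∧ dn x < 3 * δ := by
  set m := round (x - 2 * δ) with hm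
  have h2 : |x - 2 * δ - m| < δ := h
  rw [abs_lt] at h2
  refine ⟨?_, (dn_le x m).trans_lt (by rw [abs_lt]; constructor <;> linarith)⟩
  rw [dn]
  set r := round x with hr
  rcases le_or_gt r m with hle | hgt
  · have : (r : ℝ) ≤ m := by exact_mod_cast hle
    exact lt_of_lt_of_le (by linarith) (le_abs_self _)
  · have : (m : ℝ) + 1 ≤ r := by exact_mod_cast hgt
    exact lt_of_lt_of_le (by linarith) (neg_le_abs _)

/-- A minorant of `3 / ‖x‖` truncated at `‖x‖ ≥ 4^{-J}`, built from tents at the scales `4^{-j}`. -/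
noncomputable def tentSum (J : ℕ) (x : ℝ) : ℝ :=
  ∑ j ∈ Finset.Icc 1 J, (16 : ℝ) ^ j * max 0 ((4 ^ j : ℝ)⁻¹ - dn (x + -(2 * (4 ^ j : ℝ)⁻¹)))

theorem inv_four_pow_le {j : ℕ} (hj : 1 ≤ j) : ((4 : ℝ) ^ j)⁻¹ ≤ 1 / 4 := by
  rw [one_div]
  gcongr
  exact le_self_pow₀ (by norm_num) (by omega)

theorem tentSum_nonneg (J : ℕ) (x : ℝ) : 0 ≤ tentSum J x :=
  Finset.sum_nonneg fun _ _ => by positivity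

theorem hasQuadFourier_tentSum (J : ℕ) : HasQuadFourier (tentSum J) J (3 * 16 ^ J) := by
  have h := HasQuadFourier.sum (Finset.Icc 1 J) fun j hj =>
    ((hasQuadFourier_max_sub_dn (δ := ((4 : ℝ) ^ j)⁻¹) (by positivity)
      (inv_four_pow_le (Finset.mem_Icc.mp hj).1)).comp_add (-(2 * ((4 : ℝ) ^ j)⁻¹))).const_mul
      (16 ^ j)
  have e : ∑ j ∈ Finset.Icc 1 J, (16 : ℝ) ^ j * (((4 : ℝ) ^ j)⁻¹) ^ 2 = J := by
    rw [Finset.sum_congr rfl (g := fun _ => (1 : ℝ))]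
    · simp
    · intro j _
      rw [inv_pow, ← pow_mul, mul_comm j, pow_mul]
      norm_num
  have e2 : ∑ j ∈ Finset.Icc 1 J, |(16 : ℝ) ^ j| * 2 ≤ 3 * 16 ^ J := by
    clear h e
    induction J with
    | zero => simp
    | succ J ih =>
      rw [Finset.sum_Icc_succ_top (by omega), abs_of_pos (by positivity), pow_succ]
      have : (0 : ℝ) < 16 ^ J := by positivity
      linarith
  rw [e] at h
  exact h.mono e2

/-- At each point at most one tent is nonzero. -/
theorem tentSum_eq_zero_or (J : ℕ) (x : ℝ) : tentSum J x = 0 ∨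
    ∃ j ∈ Finset.Icc 1 J, tentSum J x ≤ 4 ^ j ∧ ((4 : ℝ) ^ j)⁻¹ < dn x ∧
      dn x < 3 * ((4 : ℝ) ^ j)⁻¹ := by
  by_cases hex : ∃ j ∈ Finset.Icc 1 J, dn (x - 2 * ((4 : ℝ) ^ j)⁻¹) < ((4 : ℝ) ^ j)⁻¹
  · right
    obtain ⟨j, hj, hlt⟩ := hex
    have hb := dn_bounds_of_dn_sub_lt (inv_four_pow_le (Finset.mem_Icc.mp hj).1) hlt
    refine ⟨j, hj, ?_, hb⟩
    rw [tentSum, Finset.sum_eq_single_of_mem j hj]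
    · have h1 : max 0 (((4 : ℝ) ^ j)⁻¹ - dn (x + -(2 * ((4 : ℝ) ^ j)⁻¹))) ≤ ((4 : ℝ) ^ j)⁻¹ :=
        max_le (by positivity) (by linarith [dn_nonneg (x + -(2 * ((4 : ℝ) ^ j)⁻¹))])
      calc _ ≤ (16 : ℝ) ^ j * ((4 : ℝ) ^ j)⁻¹ := by gcongr
        _ = 4 ^ j := by
          rw [show (16 : ℝ) = 4 * 4 by norm_num, mul_pow]
          field_simp
    · intro i hi hij
      rw [max_eq_left, mul_zero]
      rw [sub_nonpos, ← sub_eq_add_neg]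
      by_contra! hlt'
      have hb' := dn_bounds_of_dn_sub_lt (inv_four_pow_le (Finset.mem_Icc.mp hi).1) hlt'
      have key (a b : ℕ) (hab : a < b) : 4 * ((4 : ℝ) ^ b)⁻¹ ≤ ((4 : ℝ) ^ a)⁻¹ := by
        have : (4 : ℝ) ^ (a + 1) ≤ 4 ^ b := pow_le_pow_right₀ (by norm_num) hab
        rw [← div_eq_mul_inv, ← one_div, div_le_div_iff₀ (by positivity) (by positivity)]
        rw [pow_succ] at this
        linarith
      have : (0 : ℝ) < ((4 : ℝ) ^ i)⁻¹ := by positivity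
      have : (0 : ℝ) < ((4 : ℝ) ^ j)⁻¹ := by positivity
      rcases lt_or_gt_of_ne hij with h | h
      · linarith [key i j h]
      · linarith [key j i h]
  · left
    push Not at hex
    refine Finset.sum_eq_zero fun j hj => ?_
    rw [max_eq_left, mul_zero]
    have := hex j hj
    rw [sub_eq_add_neg] at this
    linarith

theorem tentSum_le (J : ℕ) (x : ℝ) : tentSum J x ≤ 4 ^ J := by
  rcases tentSum_eq_zero_or J x with h | ⟨j, hj, h, -⟩
  · rw [h]; positivity
  · exact h.trans (pow_le_pow_right₀ (by norm_num) (Finset.mem_Icc.mp hj).2)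

theorem tentSum_mul_dn_le (J : ℕ) (x : ℝ) : tentSum J x * dn x ≤ 3 := by
  rcases tentSum_eq_zero_or J x with h | ⟨j, hj, h, h1, h2⟩
  · rw [h]; norm_num
  · calc _ ≤ (4 : ℝ) ^ j * (3 * ((4 : ℝ) ^ j)⁻¹) :=
        mul_le_mul h h2.le (dn_nonneg _) (by positivity)
      _ = 3 := by field_simp

theorem inv_four_pow_lt_dn_of_tentSum_ne_zero {J : ℕ} {x : ℝ} (hx : tentSum J x ≠ 0) :
    ((4 : ℝ) ^ J)⁻¹ < dn x := by
  rcases tentSum_eq_zero_or J x with h | ⟨j, hj, -, h1, -⟩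
  · exact absurd h hx
  · refine lt_of_le_of_lt ?_ h1
    gcongr
    · norm_num
    · exact (Finset.mem_Icc.mp hj).2

theorem sum_Icc_neg_succ {M : Type*} [AddCommMonoid M] (f : ℤ → M) (H : ℕ) :
    ∑ h ∈ Finset.Icc (-((H + 1 : ℕ) : ℤ)) ((H + 1 : ℕ) : ℤ), f h =
      f (-((H + 1 : ℕ) : ℤ)) + f ((H + 1 : ℕ) : ℤ) + ∑ h ∈ Finset.Icc (-(H : ℤ)) H, f h := by
  have : Finset.Icc (-((H + 1 : ℕ) : ℤ)) ((H + 1 : ℕ) : ℤ) =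
      insert (-((H + 1 : ℕ) : ℤ)) (insert ((H + 1 : ℕ) : ℤ) (Finset.Icc (-(H : ℤ)) H)) := by
    ext h
    simp only [Finset.mem_insert, Finset.mem_Icc]
    push_cast
    omega
  rw [this, Finset.sum_insert, Finset.sum_insert, add_assoc]
  · simp
  · simp only [Finset.mem_insert, Finset.mem_Icc]
    push_cast
    omega

theorem one_div_succ_sq_le (H : ℕ) (hH : 1 ≤ H) :
    1 / ((H + 1 : ℕ) : ℝ) ^ 2 ≤ 1 / (H : ℝ) - 1 / ((H + 1 : ℕ) : ℝ) := by
  have : (1 : ℝ) ≤ H := by exact_mod_cast hH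
  push_cast
  rw [div_sub_div _ _ (by positivity) (by positivity), div_le_div_iff₀ (by positivity)
    (by positivity)]
  nlinarith

/-- Truncation of a Fourier series with quadratically decaying coefficients. -/
theorem HasQuadFourier.exists_truncation {F : ℝ → ℝ} {μ Q : ℝ} (hF : HasQuadFourier F μ Q)
    (hμ : 0 ≤ μ) (hQ : 0 ≤ Q) : ∃ c : ℤ → ℂ, c 0 = μ ∧
      (∀ H : ℕ, ∑ h ∈ Finset.Icc (-(H : ℤ)) H, ‖c h‖ ≤ μ + 4 * Q) ∧
      ∀ H : ℕ, 1 ≤ H → ∀ x : ℝ,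
        ‖(F x : ℂ) - ∑ h ∈ Finset.Icc (-(H : ℤ)) H, c h * ee (h * x)‖ ≤ 2 * Q / H := by
  obtain ⟨c, c0, cb, cs⟩ := hF
  have two (H : ℕ) : ‖c (-((H + 1 : ℕ) : ℤ))‖ + ‖c ((H + 1 : ℕ) : ℤ)‖ ≤
      2 * Q * (1 / ((H + 1 : ℕ) : ℝ) ^ 2) := by
    have h1 := cb (-((H + 1 : ℕ) : ℤ)) (by omega)
    have h2 := cb ((H + 1 : ℕ) : ℤ) (by omega)
    rw [Int.cast_neg, neg_sq] at h1
    rw [Int.cast_natCast] at h1 h2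
    rw [div_eq_mul_one_div] at h1 h2
    linarith
  refine ⟨c, c0, fun H => ?_, fun H hH x => ?_⟩
  · have key : ∀ n : ℕ, ∑ h ∈ Finset.Icc (-((n + 1 : ℕ) : ℤ)) ((n + 1 : ℕ) : ℤ), ‖c h‖ ≤
        μ + 4 * Q - 2 * Q * (1 / ((n + 1 : ℕ) : ℝ)) := by
      intro n
      induction n with
      | zero =>
        have := two 0
        rw [sum_Icc_neg_succ]
        norm_num [c0, abs_of_nonneg hμ] at this ⊢
        linarith
      | succ n ih =>
        rw [sum_Icc_neg_succ]
        have h1 := two (n + 1)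
        have h2 := mul_le_mul_of_nonneg_left (one_div_succ_sq_le (n + 1) (by omega))
          (show 0 ≤ 2 * Q by positivity)
        rw [mul_sub] at h2
        linarith
    rcases H with _ | n
    · simp [c0, abs_of_nonneg hμ]; exact hQ
    · refine (key n).trans ?_
      have : 0 ≤ 2 * Q * (1 / ((n + 1 : ℕ) : ℝ)) := by positivity
      linarith
  · set S : ℕ → ℂ := fun H => ∑ h ∈ Finset.Icc (-(H : ℤ)) H, c h * ee (h * x) with hS
    have key : ∀ n : ℕ, ‖S (H + n) - S H‖ ≤ 2 * Q * (1 / (H : ℝ) - 1 / ((H + n : ℕ) : ℝ)) := by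
      intro n
      induction n with
      | zero => simp
      | succ n ih =>
        have e : S (H + (n + 1)) - S H = (c (-((H + n + 1 : ℕ) : ℤ)) *
            ee ((-((H + n + 1 : ℕ) : ℤ) : ℤ) * x) +
            c ((H + n + 1 : ℕ) : ℤ) * ee (((H + n + 1 : ℕ) : ℤ) * x)) + (S (H + n) - S H) := by
          simp only [hS]
          rw [← add_assoc, sum_Icc_neg_succ]
          ring
        rw [e]
        refine (norm_add_le _ _).trans ?_
        have h0 := norm_add_le (c (-((H + n + 1 : ℕ) : ℤ)) *
            ee ((-((H + n + 1 : ℕ) : ℤ) : ℤ) * x))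
            (c ((H + n + 1 : ℕ) : ℤ) * ee (((H + n + 1 : ℕ) : ℤ) * x))
        rw [norm_mul, norm_mul, norm_ee, norm_ee, mul_one, mul_one] at h0
        have h1 := two (H + n)
        have h2 := mul_le_mul_of_nonneg_left (one_div_succ_sq_le (H + n) (by omega))
          (show 0 ≤ 2 * Q by positivity)
        rw [← add_assoc]
        linarith
    have hlim : Tendsto (fun n => S (H + n)) atTop (nhds (F x : ℂ)) := by
      have : Tendsto S atTop (nhds (F x : ℂ)) := (cs x).comp Finset.tendsto_Icc_neg
      exact this.comp (tendsto_add_atTop_nat H |>.congr fun n => add_comm _ _)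
    refine le_of_tendsto (hlim.sub_const (S H)).norm (Eventually.of_forall fun n => ?_)
    refine (key n).trans ?_
    rw [mul_div_assoc, ← mul_one_div Q (H : ℝ)]
    have : 0 ≤ 2 * Q * (1 / ((H + n : ℕ) : ℝ)) := by positivity
    linarith

theorem norm_prod_sub_prod_le {ι : Type*} (s : Finset ι) (a b : ι → ℂ) {K τ : ℝ} (hK : 1 ≤ K)
    (ha : ∀ i ∈ s, ‖a i‖ ≤ K) (hb : ∀ i ∈ s, ‖b i‖ ≤ K) (hab : ∀ i ∈ s, ‖a i - b i‖ ≤ τ) :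
    ‖∏ i ∈ s, a i - ∏ i ∈ s, b i‖ ≤ s.card * τ * K ^ s.card := by
  classical
  induction s using Finset.induction_on with
  | empty => simp
  | insert j s hj ih =>
    simp only [Finset.mem_insert, forall_eq_or_imp] at ha hb hab
    have hτ : 0 ≤ τ := (norm_nonneg _).trans hab.1
    rw [Finset.prod_insert hj, Finset.prod_insert hj, Finset.card_insert_of_notMem hj]
    have e : a j * ∏ i ∈ s, a i - b j * ∏ i ∈ s, b i =
        a j * (∏ i ∈ s, a i - ∏ i ∈ s, b i) + (a j - b j) * ∏ i ∈ s, b i := by ring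
    have hp : ‖∏ i ∈ s, b i‖ ≤ K ^ s.card := by
      rw [norm_prod]
      exact (Finset.prod_le_prod (fun _ _ => norm_nonneg _) hb.2).trans_eq (Finset.prod_const _)
    have h1 : ‖a j * (∏ i ∈ s, a i - ∏ i ∈ s, b i)‖ ≤ K * (s.card * τ * K ^ s.card) := by
      rw [norm_mul]
      exact mul_le_mul ha.1 (ih ha.2 hb.2 hab.2) (norm_nonneg _) (by linarith)
    have h2 : ‖(a j - b j) * ∏ i ∈ s, b i‖ ≤ τ * K ^ s.card := by
      rw [norm_mul]
      exact mul_le_mul hab.1 hp (norm_nonneg _) hτ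
    have h3 : τ * K ^ s.card ≤ τ * K ^ (s.card + 1) :=
      mul_le_mul_of_nonneg_left (pow_le_pow_right₀ hK (by omega)) hτ
    rw [e]
    refine (norm_add_le _ _).trans ?_
    rw [pow_succ] at h3 ⊢
    push_cast
    linarith

/-- Equidistribution of the sequence `m ↦ mθ` tested against a product of functions with
quadratically decaying Fourier coefficients. -/
theorem abs_sum_prod_sub_le {d : ℕ} {F : ℝ → ℝ} {μ Q K B : ℝ} (hF : HasQuadFourier F μ Q)
    (hμ : 0 ≤ μ) (hQ : 0 ≤ Q) (hK : 1 ≤ K) (hKμ : μ + 4 * Q ≤ K) (hFK : ∀ x, |F x| ≤ K)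
    (θ γ : Fin d → ℝ) (H : ℕ) (hH : 1 ≤ H) (M : ℕ)
    (hB : ∀ h : Fin d → ℤ, h ≠ 0 → (∀ i, |h i| ≤ H) →
      ‖∑ m ∈ Finset.Icc 1 M, ee (m * ∑ i, h i * θ i)‖ ≤ B) (hB0 : 0 ≤ B) :
    |∑ m ∈ Finset.Icc 1 M, ∏ i, F (m * θ i - γ i) - M * μ ^ d| ≤
      M * (d * (2 * Q / H) * K ^ d) + K ^ d * B := by
  classical
  obtain ⟨c, c0, cK, cF⟩ := hF.exists_truncation hμ hQ
  set I : Finset ℤ := Finset.Icc (-(H : ℤ)) H with hI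
  set P : ℝ → ℂ := fun x => ∑ h ∈ I, c h * ee (h * x) with hP
  have hPK (x : ℝ) : ‖P x‖ ≤ K := by
    refine ((norm_sum_le _ _).trans ?_).trans ((cK H).trans hKμ)
    exact Finset.sum_le_sum fun h _ => by rw [norm_mul, norm_ee, mul_one]
  have hprod (m : ℕ) : ‖(∏ i, (F (m * θ i - γ i) : ℂ)) - ∏ i, P (m * θ i - γ i)‖ ≤
      d * (2 * Q / H) * K ^ d := by
    have := norm_prod_sub_prod_le (Finset.univ : Finset (Fin d))
      (fun i => (F (m * θ i - γ i) : ℂ)) (fun i => P (m * θ i - γ i)) hK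
      (fun i _ => by simpa using hFK _) (fun i _ => hPK _) (fun i _ => cF H hH _)
    simpa using this
  have hexp (m : ℕ) : ∏ i, P (m * θ i - γ i) =
      ∑ h ∈ Fintype.piFinset fun _ : Fin d => I,
        (∏ i, c (h i) * ee (-(h i * γ i))) * ee (m * ∑ i, h i * θ i) := by
    simp only [hP]
    rw [Finset.prod_univ_sum]
    refine Finset.sum_congr rfl fun h _ => ?_
    rw [Finset.mul_sum, ee_sum, ← Finset.prod_mul_distrib]
    refine Finset.prod_congr rfl fun i _ => ?_
    rw [mul_assoc, ← ee_add]
    congr 2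
    ring
  have hmain : ‖∑ m ∈ Finset.Icc 1 M, ∏ i, P (m * θ i - γ i) - (M : ℂ) * (μ : ℂ) ^ d‖ ≤
      K ^ d * B := by
    simp_rw [hexp]
    rw [Finset.sum_comm]
    simp_rw [← Finset.mul_sum]
    have h0 : (0 : Fin d → ℤ) ∈ Fintype.piFinset fun _ : Fin d => I := by
      simp [Fintype.mem_piFinset, hI]
    rw [← Finset.add_sum_erase _ _ h0]
    have e0 : (∏ i, c ((0 : Fin d → ℤ) i) * ee (-(((0 : Fin d → ℤ) i : ℤ) * γ i))) *
        ∑ m ∈ Finset.Icc 1 M, ee (m * ∑ i, ((0 : Fin d → ℤ) i : ℤ) * θ i) =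
        (M : ℂ) * (μ : ℂ) ^ d := by
      simp [c0, ee_zero, mul_comm]
    rw [e0, add_sub_cancel_left]
    calc _ ≤ ∑ h ∈ (Fintype.piFinset fun _ : Fin d => I).erase 0, (∏ i, ‖c (h i)‖) * B := by
          refine (norm_sum_le _ _).trans (Finset.sum_le_sum fun h hh => ?_)
          rw [norm_mul, norm_prod]
          simp_rw [norm_mul, norm_ee, mul_one]
          refine mul_le_mul_of_nonneg_left (hB h (Finset.ne_of_mem_erase hh) fun i => ?_)
            (Finset.prod_nonneg fun i _ => norm_nonneg _)
          have := Fintype.mem_piFinset.mp (Finset.mem_of_mem_erase hh) i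
          rw [hI, Finset.mem_Icc] at this
          exact abs_le.mpr this
      _ ≤ ∑ h ∈ Fintype.piFinset fun _ : Fin d => I, (∏ i, ‖c (h i)‖) * B :=
          Finset.sum_le_sum_of_subset_of_nonneg (Finset.erase_subset _ _) fun h _ _ =>
            mul_nonneg (Finset.prod_nonneg fun i _ => norm_nonneg _) hB0
      _ = (∑ h ∈ I, ‖c h‖) ^ d * B := by
          rw [← Finset.sum_mul, ← Finset.prod_univ_sum (fun _ : Fin d => I) fun _ h => ‖c h‖]
          simp
      _ ≤ K ^ d * B := by
          gcongr
          exact (cK H).trans hKμ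
  have hdiff : ‖∑ m ∈ Finset.Icc 1 M, ∏ i, (F (m * θ i - γ i) : ℂ) -
      ∑ m ∈ Finset.Icc 1 M, ∏ i, P (m * θ i - γ i)‖ ≤ M * (d * (2 * Q / H) * K ^ d) := by
    rw [← Finset.sum_sub_distrib]
    refine (norm_sum_le_of_le _ fun m _ => hprod m).trans_eq ?_
    simp
  rw [← Real.norm_eq_abs, ← Complex.norm_real]
  push_cast
  refine le_trans ?_ (add_le_add hdiff hmain)
  refine le_trans (le_of_eq ?_) (norm_add_le _ _)
  congr 1
  ring

theorem one_sub_sum_inv_le_totient_div {n N : ℕ} (hn : 0 < n) (hN : n ≤ N) :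
    1 - ∑ e ∈ Finset.Icc 2 N with e ∣ n, (e : ℝ)⁻¹ ≤ (Nat.totient n : ℝ) / n := by
  have hn' : (0 : ℝ) < n := by exact_mod_cast hn
  have h1 : ∑ e ∈ n.divisors, ((n / e).totient : ℝ) = n := by
    rw [Nat.sum_div_divisors n fun e => (e.totient : ℝ)]
    exact_mod_cast Nat.sum_totient n
  have h2 : n.divisors.erase 1 = (Finset.Icc 2 N).filter (· ∣ n) := by
    ext e
    simp only [Finset.mem_erase, Nat.mem_divisors, Finset.mem_filter, Finset.mem_Icc]
    constructor
    · rintro ⟨he, hd, -⟩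
      have := Nat.le_of_dvd hn hd
      have := Nat.pos_of_dvd_of_pos hd hn
      exact ⟨⟨by omega, by omega⟩, hd⟩
    · rintro ⟨⟨he, -⟩, hd⟩
      exact ⟨by omega, hd, by omega⟩
  rw [← Finset.add_sum_erase _ _ (show 1 ∈ n.divisors by simp; omega), h2, Nat.div_one] at h1
  have h3 : ∑ e ∈ Finset.Icc 2 N with e ∣ n, ((n / e).totient : ℝ) ≤
      n * ∑ e ∈ Finset.Icc 2 N with e ∣ n, (e : ℝ)⁻¹ := by
    rw [Finset.mul_sum]
    refine Finset.sum_le_sum fun e _ => ?_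
    rw [← div_eq_mul_inv]
    refine le_trans ?_ (Nat.cast_div_le (α := ℝ))
    exact_mod_cast Nat.totient_le _
  rw [le_div_iff₀ hn']
  linarith

theorem sum_Icc_filter_dvd {e N : ℕ} (he : 0 < e) (w : ℕ → ℝ) :
    ∑ n ∈ Finset.Icc 1 N with e ∣ n, w n = ∑ m ∈ Finset.Icc 1 (N / e), w (m * e) := by
  symm
  refine Finset.sum_nbij (fun m => m * e) (fun m hm => ?_) (fun a _ b _ h => ?_) (fun n hn => ?_)
    fun _ _ => rfl
  · rw [Finset.mem_Icc] at hm
    rw [Finset.mem_filter, Finset.mem_Icc]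
    exact ⟨⟨Nat.mul_pos hm.1 he, (Nat.le_div_iff_mul_le he).mp hm.2⟩, Dvd.intro_left _ rfl⟩
  · exact Nat.eq_of_mul_eq_mul_right he h
  · rw [Finset.mem_coe, Finset.mem_filter, Finset.mem_Icc] at hn
    obtain ⟨⟨h1, h2⟩, m, rfl⟩ := hn
    refine ⟨m, ?_, mul_comm _ _⟩
    rw [Finset.mem_coe, Finset.mem_Icc, Nat.le_div_iff_mul_le he, mul_comm m]
    exact ⟨Nat.pos_of_mul_pos_left h1, h2⟩

theorem sum_sub_sum_inv_mul_le (w : ℕ → ℝ) (hw : ∀ n, 0 ≤ w n) (N : ℕ) :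
    ∑ n ∈ Finset.Icc 1 N, w n -
      ∑ e ∈ Finset.Icc 2 N, (e : ℝ)⁻¹ * ∑ m ∈ Finset.Icc 1 (N / e), w (m * e) ≤
    ∑ n ∈ Finset.Icc 1 N, w n * ((Nat.totient n : ℝ) / n) := by
  have h1 : ∑ e ∈ Finset.Icc 2 N, (e : ℝ)⁻¹ * ∑ m ∈ Finset.Icc 1 (N / e), w (m * e) =
      ∑ n ∈ Finset.Icc 1 N, w n * ∑ e ∈ Finset.Icc 2 N with e ∣ n, (e : ℝ)⁻¹ := by
    simp_rw [Finset.sum_filter, Finset.mul_sum]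
    rw [Finset.sum_comm (s := Finset.Icc 1 N)]
    refine Finset.sum_congr rfl fun e he => ?_
    rw [Finset.mem_Icc] at he
    rw [← Finset.mul_sum, ← sum_Icc_filter_dvd (by omega) w, Finset.sum_filter, Finset.mul_sum]
    refine Finset.sum_congr rfl fun n _ => ?_
    split_ifs <;> ring
  rw [h1, ← Finset.sum_sub_distrib]
  refine Finset.sum_le_sum fun n hn => ?_
  rw [Finset.mem_Icc] at hn
  have := mul_le_mul_of_nonneg_left (one_sub_sum_inv_le_totient_div hn.1 hn.2) (hw n)
  linarith

/-- If `w` has mean `A` along the multiples of every `e ≤ E`, up to an error `R`, then its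
totient-weighted sum is of the expected order. -/
theorem le_sum_mul_totient_div (w : ℕ → ℝ) (hw : ∀ n, 0 ≤ w n) {A R U : ℝ} (hA : 0 ≤ A)
    (hR : 0 ≤ R) (hU : ∀ n, w n ≤ U) {N E : ℕ} (hE : 2 ≤ E) (hEN : E ≤ N)
    (h : ∀ e : ℕ, 0 < e → e ≤ E →
      |∑ m ∈ Finset.Icc 1 (N / e), w (m * e) - ((N / e : ℕ) : ℝ) * A| ≤ R) :
    N * A / 4 - E * R - N * U / E ≤
      ∑ n ∈ Finset.Icc 1 N, w n * ((Nat.totient n : ℝ) / n) := by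
  have hU0 : 0 ≤ U := (hw 0).trans (hU 0)
  have hE0 : (2 : ℝ) ≤ E := by exact_mod_cast hE
  refine le_trans ?_ (sum_sub_sum_inv_mul_le w hw N)
  have h1 : N * A - R ≤ ∑ n ∈ Finset.Icc 1 N, w n := by
    have := (abs_le.mp (h 1 one_pos (by omega))).1
    simp only [Nat.div_one, mul_one] at this
    linarith
  have hsplit : Finset.Icc 2 N = Finset.Icc 2 E ∪ Finset.Ioc E N := by
    ext e; simp only [Finset.mem_union, Finset.mem_Icc, Finset.mem_Ioc]; omega
  have hdisj : Disjoint (Finset.Icc 2 E) (Finset.Ioc E N) := by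
    rw [Finset.disjoint_left]; intro e; simp only [Finset.mem_Icc, Finset.mem_Ioc]; omega
  have hsmall : ∑ e ∈ Finset.Icc 2 E, (e : ℝ)⁻¹ * ∑ m ∈ Finset.Icc 1 (N / e), w (m * e) ≤
      3 / 4 * (N * A) + (E - 1) * R := by
    have hterm : ∀ e ∈ Finset.Icc 2 E,
        (e : ℝ)⁻¹ * ∑ m ∈ Finset.Icc 1 (N / e), w (m * e) ≤ ((e : ℝ) ^ 2)⁻¹ * (N * A) + R := by
      intro e he
      rw [Finset.mem_Icc] at he
      have he1 : (1 : ℝ) ≤ e := by exact_mod_cast (by omega : 1 ≤ e)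
      have h2 := (abs_le.mp (h e (by omega) he.2)).2
      have h3 : ((N / e : ℕ) : ℝ) * A ≤ N / e * A := by
        gcongr
        exact Nat.cast_div_le
      have hinv : (e : ℝ)⁻¹ ≤ 1 := inv_le_one_of_one_le₀ he1
      calc _ ≤ (e : ℝ)⁻¹ * (N / e * A + R) := by gcongr; linarith
        _ = ((e : ℝ) ^ 2)⁻¹ * (N * A) + (e : ℝ)⁻¹ * R := by field_simp
        _ ≤ _ := by
          have := mul_le_mul_of_nonneg_right hinv hR
          linarith
    refine (Finset.sum_le_sum hterm).trans ?_
    rw [Finset.sum_add_distrib, ← Finset.sum_mul, Finset.sum_const, Nat.card_Icc, nsmul_eq_mul,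
      show E + 1 - 2 = E - 1 by omega, Nat.cast_sub (by omega), Nat.cast_one]
    have h4 : ∑ e ∈ Finset.Icc 2 E, ((e : ℝ) ^ 2)⁻¹ ≤ 3 / 4 := by
      have h5 := sum_Ioc_inv_sq_le_sub (α := ℝ) two_ne_zero hE
      rw [← Finset.add_sum_Ioc_eq_sum_Icc hE]
      have : (0 : ℝ) ≤ (E : ℝ)⁻¹ := by positivity
      norm_num at h5 ⊢
      linarith
    have := mul_le_mul_of_nonneg_right h4 (show 0 ≤ (N : ℝ) * A by positivity)
    linarith
  have hlarge : ∑ e ∈ Finset.Ioc E N, (e : ℝ)⁻¹ * ∑ m ∈ Finset.Icc 1 (N / e), w (m * e) ≤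
      N * U / E := by
    have hterm : ∀ e ∈ Finset.Ioc E N,
        (e : ℝ)⁻¹ * ∑ m ∈ Finset.Icc 1 (N / e), w (m * e) ≤ ((e : ℝ) ^ 2)⁻¹ * (N * U) := by
      intro e he
      rw [Finset.mem_Ioc] at he
      have he0 : (0 : ℝ) < e := by exact_mod_cast (by omega : 0 < e)
      have h2 : ∑ m ∈ Finset.Icc 1 (N / e), w (m * e) ≤ N / e * U := by
        refine (Finset.sum_le_card_nsmul _ _ _ fun m _ => hU _).trans ?_
        rw [Nat.card_Icc, Nat.add_sub_cancel, nsmul_eq_mul]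
        gcongr
        exact Nat.cast_div_le
      calc _ ≤ (e : ℝ)⁻¹ * (N / e * U) := by gcongr
        _ = _ := by field_simp
    refine (Finset.sum_le_sum hterm).trans ?_
    rw [← Finset.sum_mul]
    have h5 := sum_Ioc_inv_sq_le_sub (α := ℝ) (show E ≠ 0 by omega) hEN
    have h6 : ∑ e ∈ Finset.Ioc E N, ((e : ℝ) ^ 2)⁻¹ ≤ (E : ℝ)⁻¹ := by
      have : (0 : ℝ) ≤ (N : ℝ)⁻¹ := by positivity
      linarith
    rw [div_eq_inv_mul]
    gcongr
  rw [hsplit, Finset.sum_union hdisj]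
  linarith

/-- The totient-weighted restricted sum `T*_N(α, γ)`. -/
noncomputable def restrictedSum {d : ℕ} (α γ : Fin d → ℝ) (ε : ℝ) (N : ℕ) : ℝ :=
  ∑ n ∈ Finset.Icc 1 N, Set.indicator (Gset α γ ε)
    (fun n => (Nat.totient n : ℝ) / ((n : ℝ) * ∏ i, dn ((n : ℝ) * α i - γ i))) n

theorem prod_tentSum_mul_totient_div_le {d : ℕ} (α γ : Fin d → ℝ) {ε : ℝ} {J D n : ℕ} (hn : 0 < n)
    (hD : 1 ≤ D * Real.sqrt ε) :
    (∏ i, tentSum J (n * α i - γ i)) * ((Nat.totient n : ℝ) / n) ≤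
      3 ^ d * Set.indicator (Gset α γ ε)
        (fun n => (Nat.totient n : ℝ) / ((n : ℝ) * ∏ i, dn ((n : ℝ) * α i - γ i))) n +
      if n < (4 ^ J) ^ D then ((4 : ℝ) ^ J) ^ d else 0 := by
  have hn' : (0 : ℝ) < n := by exact_mod_cast hn
  have hw0 : 0 ≤ ∏ i, tentSum J (n * α i - γ i) :=
    Finset.prod_nonneg fun i _ => tentSum_nonneg _ _
  have hind : 0 ≤ Set.indicator (Gset α γ ε)
      (fun n : ℕ => (Nat.totient n : ℝ) / ((n : ℝ) * ∏ i, dn ((n : ℝ) * α i - γ i))) n :=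
    Set.indicator_nonneg (fun n _ => div_nonneg (Nat.cast_nonneg _)
      (mul_nonneg (Nat.cast_nonneg _) (Finset.prod_nonneg fun i _ => dn_nonneg _))) n
  split_ifs with hlt
  · have h1 : ∏ i, tentSum J (n * α i - γ i) ≤ ((4 : ℝ) ^ J) ^ d := by
      refine (Finset.prod_le_prod (fun i _ => tentSum_nonneg _ _)
        fun i _ => tentSum_le _ _).trans_eq ?_
      simp
    have h2 : (Nat.totient n : ℝ) / n ≤ 1 := by
      rw [div_le_one hn']
      exact_mod_cast Nat.totient_le n
    have h3 := mul_le_mul h1 h2 (by positivity) (by positivity)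
    have h4 := mul_nonneg (show (0 : ℝ) ≤ 3 ^ d by positivity) hind
    linarith
  · rw [add_zero]
    by_cases hz : ∏ i, tentSum J (n * α i - γ i) = 0
    · rw [hz, zero_mul]
      positivity
    have hz' (i : Fin d) : ((4 : ℝ) ^ J)⁻¹ < dn (n * α i - γ i) :=
      inv_four_pow_lt_dn_of_tentSum_ne_zero fun h => hz (Finset.prod_eq_zero (Finset.mem_univ i) h)
    have hG : n ∈ Gset α γ ε := by
      intro i
      refine le_trans ?_ (hz' i).le
      rw [Real.rpow_neg hn'.le]
      gcongr
      have h1 : (((4 : ℝ) ^ J) ^ D) ≤ n := by exact_mod_cast not_lt.mp hlt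
      calc (4 : ℝ) ^ J = ((4 : ℝ) ^ J) ^ (1 : ℝ) := (Real.rpow_one _).symm
        _ ≤ ((4 : ℝ) ^ J) ^ (D * Real.sqrt ε) :=
            Real.rpow_le_rpow_of_exponent_le (one_le_pow₀ (by norm_num)) hD
        _ = (((4 : ℝ) ^ J) ^ D) ^ Real.sqrt ε := by
            rw [Real.rpow_mul (by positivity), Real.rpow_natCast]
        _ ≤ (n : ℝ) ^ Real.sqrt ε := Real.rpow_le_rpow (by positivity) h1 (Real.sqrt_nonneg _)
    rw [Set.indicator_of_mem hG]
    have hP : 0 < ∏ i, dn (n * α i - γ i) :=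
      Finset.prod_pos fun i _ => lt_trans (by positivity) (hz' i)
    have h3 : (∏ i, tentSum J (n * α i - γ i)) * ∏ i, dn (n * α i - γ i) ≤ 3 ^ d := by
      rw [← Finset.prod_mul_distrib]
      refine (Finset.prod_le_prod (fun i _ => mul_nonneg (tentSum_nonneg _ _) (dn_nonneg _))
        fun i _ => tentSum_mul_dn_le _ _).trans_eq ?_
      simp
    rw [← le_div_iff₀ hP] at h3
    refine (mul_le_mul_of_nonneg_right h3 (by positivity)).trans_eq ?_
    field_simp

theorem sum_prod_tentSum_le {d : ℕ} (α γ : Fin d → ℝ) {ε : ℝ} {J D : ℕ} (N : ℕ)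
    (hD : 1 ≤ D * Real.sqrt ε) :
    ∑ n ∈ Finset.Icc 1 N, (∏ i, tentSum J (n * α i - γ i)) * ((Nat.totient n : ℝ) / n) ≤
      3 ^ d * restrictedSum α γ ε N + ((4 : ℝ) ^ J) ^ D * ((4 : ℝ) ^ J) ^ d := by
  refine (Finset.sum_le_sum fun n hn =>
    prod_tentSum_mul_totient_div_le α γ (Finset.mem_Icc.mp hn).1 hD).trans ?_
  rw [Finset.sum_add_distrib, ← Finset.mul_sum, restrictedSum]
  gcongr
  rw [← Finset.sum_filter, Finset.sum_const, nsmul_eq_mul]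
  gcongr
  have : (Finset.Icc 1 N).filter (· < (4 ^ J) ^ D) ⊆ Finset.range ((4 ^ J) ^ D) := fun n hn =>
    Finset.mem_range.mpr (Finset.mem_filter.mp hn).2
  have := Finset.card_le_card this
  rw [Finset.card_range] at this
  exact_mod_cast this

theorem abs_sum_prod_tentSum_sub_le {d : ℕ} (α γ : Fin d → ℝ) {C W : ℕ}
    (hα : ∀ h : Fin d → ℤ, h ≠ 0 → ∀ H : ℕ, (∀ i, |h i| ≤ H) →
      1 ≤ (C : ℝ) * (H : ℝ) ^ W * dn (∑ i, h i * α i))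
    {J H E M e : ℕ} (hH : 1 ≤ H) (he : 0 < e) (heE : e ≤ E) :
    |∑ m ∈ Finset.Icc 1 M, ∏ i, tentSum J ((m * e : ℕ) * α i - γ i) - M * (J : ℝ) ^ d| ≤
      M * (d * (2 * (3 * 16 ^ J) / H) * (13 * 16 ^ J) ^ d) +
        (13 * 16 ^ J) ^ d * (C * (E * H : ℝ) ^ W) := by
  have hJ : (J : ℝ) ≤ 16 ^ J := by exact_mod_cast (Nat.lt_pow_self (by norm_num)).le
  have h1 : (1 : ℝ) ≤ 16 ^ J := one_le_pow₀ (by norm_num)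
  have h4 : (4 : ℝ) ^ J ≤ 16 ^ J := by gcongr; norm_num
  have := abs_sum_prod_sub_le (hasQuadFourier_tentSum J) (K := 13 * 16 ^ J)
    (B := C * (E * H : ℝ) ^ W) (by positivity) (by positivity) (by linarith) (by linarith)
    (fun x => by rw [abs_of_nonneg (tentSum_nonneg J x)]; linarith [tentSum_le J x])
    (fun i => e * α i) γ H hH M (fun h h0 hh => ?_) (by positivity)
  · convert this using 7
    push_cast
    ring
  · have e0 : (fun i => (e : ℤ) * h i) ≠ 0 := by
      intro hz
      refine h0 (funext fun i => ?_)
      have := congrFun hz i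
      simp only [Pi.zero_apply, mul_eq_zero] at this
      rcases this with h | h
      · omega
      · exact h
    have hb := hα (fun i => (e : ℤ) * h i) e0 (E * H) fun i => by
      rw [abs_mul, Nat.abs_cast]
      push_cast
      exact mul_le_mul (by exact_mod_cast heE) (hh i) (abs_nonneg _) (by positivity)
    have hs : ∑ i, (((e : ℤ) * h i : ℤ) : ℝ) * α i = ∑ i, (h i : ℝ) * (e * α i) :=
      Finset.sum_congr rfl fun i _ => by push_cast; ring
    rw [hs] at hb
    push_cast at hb
    set x := ∑ i, (h i : ℝ) * (e * α i)
    have hg := norm_sum_ee_mul_dn_le M x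
    have hc : (0 : ℝ) ≤ C * (E * H : ℝ) ^ W := by positivity
    calc _ ≤ ‖∑ m ∈ Finset.Icc 1 M, ee (m * x)‖ * (C * (E * H : ℝ) ^ W * dn x) :=
          le_mul_of_one_le_right (norm_nonneg _) hb
      _ = C * (E * H : ℝ) ^ W * (‖∑ m ∈ Finset.Icc 1 M, ee (m * x)‖ * dn x) := by ring
      _ ≤ C * (E * H : ℝ) ^ W := mul_le_of_le_one_right hc hg

theorem le_restrictedSum {d : ℕ} (α γ : Fin d → ℝ) {C W : ℕ}
    (hα : ∀ h : Fin d → ℤ, h ≠ 0 → ∀ H : ℕ, (∀ i, |h i| ≤ H) →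
      1 ≤ (C : ℝ) * (H : ℝ) ^ W * dn (∑ i, h i * α i))
    {ε : ℝ} {D : ℕ} (hD : 1 ≤ D * Real.sqrt ε) {J N : ℕ} (hJ : 1 ≤ J)
    (hN : (4 ^ J) ^ (D + (3 * d + 2 + (4 * d + 5) * W)) ≤ N) :
    N * (J : ℝ) ^ d / 4 - (6 * d * 13 ^ d + 13 ^ d * C + 2) * (N / 4 ^ J) ≤
      3 ^ d * restrictedSum α γ ε N := by
  set L : ℕ := 4 ^ J with hL
  have hL4 : 4 ≤ L := le_self_pow₀ (by norm_num) (by omega)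
  have hL0 : (0 : ℝ) < L := by exact_mod_cast (by omega : 0 < L)
  have hpow {t : ℕ} (ht : t ≤ D + (3 * d + 2 + (4 * d + 5) * W)) : L ^ t ≤ N :=
    (Nat.pow_le_pow_right (by omega) ht).trans hN
  have hpowR {t : ℕ} (ht : t + 1 ≤ D + (3 * d + 2 + (4 * d + 5) * W)) :
      (L : ℝ) ^ t ≤ N / L := by
    rw [le_div_iff₀ hL0, ← pow_succ]
    exact_mod_cast hpow ht
  have h16 : (16 : ℝ) ^ J = (L : ℝ) ^ 2 := by
    rw [hL]; push_cast; rw [← pow_mul, mul_comm, pow_mul]; norm_num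
  have h4 : (4 : ℝ) ^ J = L := by rw [hL]; push_cast; rfl
  have hE2 : 2 ≤ L ^ (d + 1) := le_trans (by omega) (Nat.le_self_pow (by omega) L)
  have hmain := le_sum_mul_totient_div (fun n : ℕ => ∏ i, tentSum J (n * α i - γ i))
    (fun n => Finset.prod_nonneg fun i _ => tentSum_nonneg _ _) (A := (J : ℝ) ^ d)
    (R := N * (d * (2 * (3 * 16 ^ J) / (L ^ (3 * d + 4) : ℕ)) * (13 * 16 ^ J) ^ d) +
        (13 * 16 ^ J) ^ d * (C * ((L ^ (d + 1) : ℕ) * (L ^ (3 * d + 4) : ℕ) : ℝ) ^ W))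
    (U := (L : ℝ) ^ d) (by positivity) (by positivity)
    (fun n => by
      refine (Finset.prod_le_prod (fun i _ => tentSum_nonneg _ _)
        fun i _ => tentSum_le _ _).trans_eq ?_
      simp [hL])
    hE2 (hpow (by nlinarith)) (fun e he heE => by
      refine (abs_sum_prod_tentSum_sub_le α γ hα (H := L ^ (3 * d + 4))
        (Nat.one_le_pow _ _ (by omega)) he heE).trans ?_
      gcongr
      exact Nat.div_le_self _ _)
  have hup := sum_prod_tentSum_le α γ (J := J) N hD
  rw [h16] at hmain
  rw [h4] at hup ⊢
  have t1 : ((L ^ (d + 1) : ℕ) : ℝ) * (N * (d * (2 * (3 * (L : ℝ) ^ 2) / (L ^ (3 * d + 4) : ℕ)) *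
      (13 * (L : ℝ) ^ 2) ^ d)) = 6 * d * 13 ^ d * (N / L) := by
    push_cast
    rw [mul_pow, ← pow_mul]
    field_simp
    ring
  have t2 : ((L ^ (d + 1) : ℕ) : ℝ) * ((13 * (L : ℝ) ^ 2) ^ d *
      (C * ((L ^ (d + 1) : ℕ) * (L ^ (3 * d + 4) : ℕ) : ℝ) ^ W)) ≤ 13 ^ d * C * (N / L) := by
    have e : ((L ^ (d + 1) : ℕ) : ℝ) * ((13 * (L : ℝ) ^ 2) ^ d *
      (C * ((L ^ (d + 1) : ℕ) * (L ^ (3 * d + 4) : ℕ) : ℝ) ^ W)) =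
        13 ^ d * C * (L : ℝ) ^ (3 * d + 1 + (4 * d + 5) * W) := by
      push_cast
      rw [mul_pow, ← pow_mul, ← pow_add, ← pow_mul]
      ring
    rw [e]
    gcongr
    exact hpowR (by omega)
  have t3 : (N : ℝ) * (L : ℝ) ^ d / (L ^ (d + 1) : ℕ) = N / L := by
    push_cast
    field_simp
    ring
  have t4 : (L : ℝ) ^ D * (L : ℝ) ^ d ≤ N / L := by
    rw [← pow_add]
    exact hpowR (by omega)
  rw [mul_add, t3, t1] at hmain
  linarith

theorem exists_le_restrictedSum {d : ℕ} (α γ : Fin d → ℝ) {c v : ℝ} (hc : 0 < c)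
    (hv : 0 ≤ v) (hvd : v * ((d : ℝ) - 1) < d)
    (hα : ∀ n : ℕ, 0 < n → c * (n : ℝ) ^ (-v) ≤ ∏ i, dn (n * α i)) {ε : ℝ} (hε : 0 < ε) :
    ∃ c : ℝ, 0 < c ∧ ∃ N₀ : ℕ, ∀ N : ℕ, N₀ ≤ N →
      c * (N * Real.log N ^ d) ≤ restrictedSum α γ ε N := by
  obtain ⟨C, W, -, hdual⟩ := exists_forall_one_le_mul_dn_sum α hc hv hvd hα
  have hs : 0 < Real.sqrt ε := Real.sqrt_pos.mpr hε
  obtain ⟨D, hD⟩ := exists_nat_ge (1 / Real.sqrt ε)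
  rw [div_le_iff₀ hs] at hD
  set T := D + (3 * d + 2 + (4 * d + 5) * W) with hT
  have hT0 : 0 < T := by omega
  have hTr : (0 : ℝ) < T := by exact_mod_cast hT0
  set K : ℝ := 6 * d * 13 ^ d + 13 ^ d * C + 2 with hK
  obtain ⟨J₀, hJ₀⟩ := pow_unbounded_of_one_lt (8 * K) (show (1 : ℝ) < 4 by norm_num)
  refine ⟨(8 * 3 ^ d * (4 * T) ^ d)⁻¹, by positivity, (4 ^ T) ^ (J₀ + 1), fun N hN => ?_⟩
  have hb : 1 < 4 ^ T := Nat.one_lt_pow (by omega) (by norm_num)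
  have hN0 : N ≠ 0 := by
    have : 0 < (4 ^ T) ^ (J₀ + 1) := by positivity
    omega
  have hNr : (0 : ℝ) < N := by exact_mod_cast Nat.pos_of_ne_zero hN0
  set J := Nat.log (4 ^ T) N with hJ
  have hJJ : J₀ + 1 ≤ J := (Nat.le_log_iff_pow_le hb hN0).mpr hN
  have hJ1 : (1 : ℝ) ≤ J := by exact_mod_cast (by omega : 1 ≤ J)
  have h1 : (4 ^ J) ^ T ≤ N := by
    rw [← pow_mul, mul_comm, pow_mul]
    exact Nat.pow_log_le_self _ hN0
  have h2 : Real.log N ≤ 4 * T * J := by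
    have h3 : (N : ℝ) ≤ (4 ^ T) ^ (J + 1) := by
      exact_mod_cast (Nat.lt_pow_succ_log_self hb N).le
    have h4 := Real.log_le_log hNr h3
    rw [Real.log_pow, Real.log_pow] at h4
    have h5 : Real.log 4 ≤ 2 := by
      rw [show (4 : ℝ) = 2 ^ 2 by norm_num, Real.log_pow]
      have := Real.log_two_lt_d9
      push_cast
      linarith
    refine h4.trans ?_
    calc ((J + 1 : ℕ) : ℝ) * (T * Real.log 4) ≤ (2 * J) * (T * 2) := by
          gcongr
          push_cast
          linarith
      _ = _ := by ring
  have h3 := le_restrictedSum α γ hdual hD (by omega : 1 ≤ J) h1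
  have h4 : K * (N / 4 ^ J) ≤ N / 8 := by
    have : (4 : ℝ) ^ J₀ ≤ 4 ^ J := pow_le_pow_right₀ (by norm_num) (by omega)
    rw [← mul_div_assoc, div_le_div_iff₀ (by positivity) (by norm_num)]
    nlinarith
  have h5 : (N : ℝ) ≤ N * (J : ℝ) ^ d := le_mul_of_one_le_right hNr.le (one_le_pow₀ hJ1)
  have h6 : Real.log N ^ d ≤ (4 * T) ^ d * (J : ℝ) ^ d := by
    rw [← mul_pow]
    exact pow_le_pow_left₀ (Real.log_natCast_nonneg _) h2 _
  have h7 : N * (J : ℝ) ^ d / 8 ≤ 3 ^ d * restrictedSum α γ ε N := by linarith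
  rw [inv_mul_le_iff₀ (by positivity)]
  have h8 : (N : ℝ) * Real.log N ^ d ≤ (4 * T) ^ d * (N * (J : ℝ) ^ d) := by
    calc _ ≤ N * ((4 * T) ^ d * (J : ℝ) ^ d) := by gcongr
      _ = _ := by ring
  have h9 : (4 * T : ℝ) ^ d * (N * (J : ℝ) ^ d / 8) ≤
      (4 * T) ^ d * (3 ^ d * restrictedSum α γ ε N) := by gcongr
  linarith

/-- Lower bound for the totient-weighted restricted sum:
`T*_N(α, γ) = ∑_{n ≤ N, n ∈ G} φ(n)/(n ‖nα₁-γ₁‖⋯‖nα_{k-1}-γ_{k-1}‖) ≥ c N (log N)^{k-1}`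
for all large `N`. -/
theorem restricted_sum_lower (k : ℕ) (hk : 2 ≤ k) (α γ : Fin (k - 1) → ℝ)
    (hα : multExp α < mBound k) :
    ∃ ε0 : ℝ, 0 < ε0 ∧ ∀ ε : ℝ, 0 < ε → ε ≤ ε0 →
      ∃ c : ℝ, 0 < c ∧ ∃ N0 : ℕ, ∀ N : ℕ, N0 ≤ N →
        c * (N * Real.log N ^ (k - 1)) ≤
          ∑ n ∈ Finset.Icc 1 N,
            Set.indicator (Gset α γ ε)
              (fun n => (Nat.totient n : ℝ) /
                ((n : ℝ) * ∏ i, dn ((n : ℝ) * α i - γ i))) n := by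
  obtain ⟨v, hv0, hv1, hv2⟩ : ∃ v : ℝ, 0 ≤ v ∧ multExp α < (v : EReal) ∧
      v * (((k - 1 : ℕ) : ℝ) - 1) < ((k - 1 : ℕ) : ℝ) := by
    have hk1 : ((k - 1 : ℕ) : ℝ) = k - 1 := by rw [Nat.cast_sub (by omega), Nat.cast_one]
    have hk2 : (2 : ℝ) ≤ k := by exact_mod_cast hk
    have hm : max (multExp α) 0 < mBound k := by
      refine max_lt hα ?_
      rw [mBound]
      split_ifs with h
      · exact EReal.coe_lt_top 0
      · have : (2 : ℝ) < k := by exact_mod_cast (by omega : 2 < k)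
        exact_mod_cast div_pos (by linarith : (0 : ℝ) < k - 1) (by linarith : (0 : ℝ) < k - 2)
    obtain ⟨v, h1, h2⟩ := EReal.lt_iff_exists_real_btwn.mp hm
    have h0 : (0 : EReal) < v := (le_max_right _ _).trans_lt h1
    refine ⟨v, by exact_mod_cast h0.le, (le_max_left _ _).trans_lt h1, ?_⟩
    rw [hk1]
    rw [mBound] at h2
    split_ifs at h2 with h
    · rw [h]
      norm_num
    · have h3 : (2 : ℝ) < k := by exact_mod_cast (by omega : 2 < k)
      rw [EReal.coe_lt_coe_iff, lt_div_iff₀ (by linarith)] at h2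
      linarith
  obtain ⟨c, hc, h⟩ := exists_le_prod_dn α v hv1
  exact ⟨1, one_pos, fun ε hε _ => exists_le_restrictedSum α γ hc hv0 hv2 h hε⟩
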